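/- Let (Γ_q, i_q) be a Bourgain–Delbaen system on Γ with associated Bourgain–Delbaen space X, and let Γ' be a self-determined subset of Γ. Then for every s ∈ ℕ∪{0} and every x ∈ ℓ∞(Γ_{q_s}) one has R(i_{q_s}(x)) = i'_{q_s}(r'_{q_s}(R̃(x))), where R̃(x) ∈ ℓ∞(Γ'_{q_s}) denotes the restriction of x to Γ'_{q_s}. Equivalently, R(i_{q_s}(x)) depends only on the restriction of x to Γ'_{q_s}; in particular, if x vanishes on Γ'_{q_s} then R(i_{q_s}(x)) = 0. -/

import Mathlib

noncomputable section
open scoped ENNReal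

/-- `ℓ∞(Γ)`. -/
abbrev Linfty (Γ : Type) := lp (fun _ : Γ => ℝ) ∞

/-- The evaluation functional `f ↦ f γ` on `ℓ∞(Γ)`. -/
def evalLinfty {Γ : Type} (γ : Γ) : Linfty Γ →L[ℝ] ℝ :=
  LinearMap.mkContinuous
    { toFun := fun f => f γ
      map_add' := fun f g => by simp [lp.coeFn_add]
      map_smul' := fun c f => by simp [lp.coeFn_smul] }
    1 (fun f => by
      rw [one_mul]
      exact lp.norm_apply_le_norm ENNReal.top_ne_zero f γ)

/-- The restriction operator `r_s : ℓ∞(Γ) → ℓ∞(s)` for a finite subset `s` of `Γ`;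
the target carries the sup norm. -/
def restrFin {Γ : Type} (s : Finset Γ) : Linfty Γ →L[ℝ] (↥s → ℝ) :=
  LinearMap.mkContinuous
    { toFun := fun f γ => f (γ : Γ)
      map_add' := fun f g => by funext γ; simp [lp.coeFn_add]
      map_smul' := fun c f => by funext γ; simp [lp.coeFn_smul] }
    1 (fun f => by
      rw [one_mul]
      refine (pi_norm_le_iff_of_nonneg (norm_nonneg f)).mpr ?_
      intro γ
      exact lp.norm_apply_le_norm ENNReal.top_ne_zero f (γ : Γ))

/-- A Bourgain–Delbaen system on a set `Γ`: a strictly increasing sequence of finite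
subsets of `Γ` with union `Γ`, together with a uniformly bounded compatible sequence of
extension operators.  We use the convention `Gam 0 = ∅`, so that for `q ≥ 1` the set
`Gam q` is the set `Γ_q` of the paper (all of them nonempty, by strict monotonicity). -/
structure BDSystem (Γ : Type) where
  Gam : ℕ → Finset Γ
  Gam_zero : Gam 0 = ∅
  mono : StrictMono Gam
  exhaustive : ∀ γ : Γ, ∃ q, γ ∈ Gam q
  i : ∀ q : ℕ, (↥(Gam q) → ℝ) →L[ℝ] Linfty Γ
  isExtension : ∀ (q : ℕ) (x : ↥(Gam q) → ℝ) (γ : ↥(Gam q)), (i q x) (γ : Γ) = x γ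
  compatible : ∀ p q : ℕ, p < q → ∀ x : ↥(Gam p) → ℝ,
      i p x = i q (fun γ : ↥(Gam q) => (i p x) (γ : Γ))
  normBound : ℝ
  norm_i_le : ∀ q, ‖i q‖ ≤ normBound

namespace BDSystem

variable {Γ : Type} (S : BDSystem Γ)

/-- The constant `C = sup_q ‖i_q‖` of the system. -/
def const : ℝ := ⨆ q, ‖S.i q‖

/-- The rank of `γ`: the unique `q` with `γ ∈ Δ_q = Γ_q ∖ Γ_{q-1}`, i.e. the least `q`
with `γ ∈ Γ_q`. -/
def rank (γ : Γ) : ℕ := @Nat.find _ (Classical.decPred _) (S.exhaustive γ)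

/-- The vector `d_γ = i_q (e_γ) ∈ ℓ∞(Γ)`, where `q = rank γ`. -/
def dvec (γ : Γ) : Linfty Γ :=
  S.i (S.rank γ) (fun η => @ite _ ((η : Γ) = γ) (Classical.dec _) 1 0)

/-- The Bourgain–Delbaen space `X`, the closed linear span of `{d_γ : γ ∈ Γ}`,
as a closed submodule of `ℓ∞(Γ)`. -/
def X : Submodule ℝ (Linfty Γ) :=
  (Submodule.span ℝ (Set.range S.dvec)).topologicalClosure

theorem dvec_mem_X (γ : Γ) : S.dvec γ ∈ S.X :=
  (Submodule.span ℝ (Set.range S.dvec)).le_topologicalClosure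
    (Submodule.subset_span (Set.mem_range_self γ))

/-- `d_γ` as an element of the space `X`. -/
def dX (γ : Γ) : ↥S.X := ⟨S.dvec γ, S.dvec_mem_X γ⟩

/-- The evaluation functional `e_γ^* ∈ X^*`. -/
def evalX (γ : Γ) : StrongDual ℝ ↥S.X :=
  (evalLinfty γ).comp S.X.subtypeL

/-- The cumulative projection `P_{[1,q]}`: the restriction to `X` of `i_q ∘ r_q`
(with values in `ℓ∞(Γ)`).  Note that `P_{[1,0]} = 0`, since `Gam 0 = ∅`. -/
def P (q : ℕ) : ↥S.X →L[ℝ] Linfty Γ :=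
  ((S.i q).comp (restrFin (S.Gam q))).comp S.X.subtypeL

/-- `P_{[1,q]}` for `q ∈ ℕ ∪ {∞}`, where `P_{[1,∞]}` is the inclusion of `X` into `ℓ∞(Γ)`. -/
def Pcum : ℕ∞ → (↥S.X →L[ℝ] Linfty Γ)
  | (q : ℕ) => S.P q
  | ⊤ => S.X.subtypeL

/-- The projection `P_E` associated to the interval `E = (p, q]` of `ℕ` (`q = ⊤` allowed). -/
def PE (p : ℕ) (q : ℕ∞) : ↥S.X →L[ℝ] Linfty Γ := S.Pcum q - S.P p

/-- The functional `d_γ^* = e_γ^* ∘ P_{(rank γ − 1, rank γ]}`, biorthogonal to `d_γ`. -/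
def dstar (γ : Γ) : StrongDual ℝ ↥S.X :=
  (evalLinfty γ).comp (S.PE (S.rank γ - 1) (S.rank γ))

/-- The functional `c_γ^* = e_γ^* − d_γ^*`. -/
def cstar (γ : Γ) : StrongDual ℝ ↥S.X := S.evalX γ - S.dstar γ

/-- A subset `Γ'` of `Γ` is self-determined if it is infinite and for every `γ ∈ Γ'` the
functional `d_γ^*` lies in the linear span of `{e_η^* : η ∈ Γ'}` in `X^*`. -/
def SelfDetermined (Γ' : Set Γ) : Prop :=
  Γ'.Infinite ∧ ∀ γ ∈ Γ', S.dstar γ ∈ Submodule.span ℝ (S.evalX '' Γ')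

end BDSystem

/-- The restriction operator `R : ℓ∞(Γ) → ℓ∞(Γ')` for a subset `Γ'` of `Γ`. -/
def restrSet {Γ : Type} (Γ' : Set Γ) : Linfty Γ →L[ℝ] Linfty ↥Γ' :=
  LinearMap.mkContinuous
    { toFun := fun f => ⟨fun γ => f (γ : Γ), memℓp_infty ⟨‖f‖, by
        rintro x ⟨γ, rfl⟩
        exact lp.norm_apply_le_norm ENNReal.top_ne_zero f (γ : Γ)⟩⟩
      map_add' := fun f g => by ext γ; simp [lp.coeFn_add]; rfl
      map_smul' := fun c f => by ext γ; simp [lp.coeFn_smul] }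
    1 (fun f => by
      rw [one_mul]
      refine lp.norm_le_of_forall_le (norm_nonneg f) ?_
      intro γ
      exact lp.norm_apply_le_norm ENNReal.top_ne_zero f (γ : Γ))

/-- The finite subset `Γ' ∩ s` of `Γ'`, for a finite subset `s` of `Γ`. -/
def subFin {Γ : Type} (Γ' : Set Γ) (s : Finset Γ) : Finset ↥Γ' :=
  letI := Classical.decPred (· ∈ Γ'); s.subtype (· ∈ Γ')

theorem mem_subFin {Γ : Type} {Γ' : Set Γ} {s : Finset Γ} {x : ↥Γ'} :
    x ∈ subFin Γ' s ↔ (x : Γ) ∈ s := by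
  letI := Classical.decPred (· ∈ Γ')
  simp [subFin, Finset.mem_subtype]

/-- Extension by zero, from functions on `Γ' ∩ s` to functions on `s`. -/
def extZero {Γ : Type} (Γ' : Set Γ) (s : Finset Γ) :
    (↥(subFin Γ' s) → ℝ) →L[ℝ] (↥s → ℝ) :=
  LinearMap.toContinuousLinearMap
    { toFun := fun x η =>
        @dite _ ((η : Γ) ∈ Γ') (Classical.dec _)
          (fun h => x ⟨⟨η, h⟩, mem_subFin.mpr η.2⟩) (fun _ => 0)
      map_add' := fun x y => by
        funext η
        by_cases h : (η : Γ) ∈ Γ'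
        · simp only [Pi.add_apply, dif_pos h]
        · simp only [Pi.add_apply, dif_neg h, add_zero]
      map_smul' := fun c x => by
        funext η
        by_cases h : (η : Γ) ∈ Γ'
        · simp only [Pi.smul_apply, dif_pos h, RingHom.id_apply, smul_eq_mul]
        · simp only [Pi.smul_apply, dif_neg h, RingHom.id_apply, smul_eq_mul, mul_zero] }

/-- Restriction of a function on `s` to a function on `Γ' ∩ s`. -/
def resSub {Γ : Type} (Γ' : Set Γ) (s : Finset Γ) (x : ↥s → ℝ) : ↥(subFin Γ' s) → ℝ :=
  fun η => x ⟨(η : Γ), mem_subFin.mp η.2⟩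

namespace BDSystem

variable {Γ : Type} (S : BDSystem Γ)

/-- The induced extension operator `i'_q : ℓ∞(Γ' ∩ Γ_q) → ℓ∞(Γ')`, defined by
`i'_q(x) = R (i_q (x̃))`, where `x̃` is the extension of `x` by zero. -/
def iInd (Γ' : Set Γ) (q : ℕ) : (↥(subFin Γ' (S.Gam q)) → ℝ) →L[ℝ] Linfty ↥Γ' :=
  ((restrSet Γ').comp (S.i q)).comp (extZero Γ' (S.Gam q))

end BDSystem

namespace BDSystem

theorem rank_spec {Γ : Type} (S : BDSystem Γ) (γ : Γ) : γ ∈ S.Gam (S.rank γ) :=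
  @Nat.find_spec _ (Classical.decPred _) (S.exhaustive γ)

theorem rank_le {Γ : Type} (S : BDSystem Γ) {γ : Γ} {q : ℕ} (h : γ ∈ S.Gam q) :
    S.rank γ ≤ q :=
  @Nat.find_min' _ (Classical.decPred _) (S.exhaustive γ) q h

theorem mem_Gam_iff {Γ : Type} (S : BDSystem Γ) {γ : Γ} {q : ℕ} :
    γ ∈ S.Gam q ↔ S.rank γ ≤ q :=
  ⟨S.rank_le, fun h => S.mono.monotone h (S.rank_spec γ)⟩

theorem dvec_eq {Γ : Type} (S : BDSystem Γ) {γ : Γ} {q : ℕ} (h : S.rank γ = q) :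
    S.i q (fun η => @ite _ ((η : Γ) = γ) (Classical.dec _) 1 0) = S.dvec γ := by
  subst h; rfl

theorem i_restr {Γ : Type} (S : BDSystem Γ) {p q : ℕ} (h : p ≤ q) (x : ↥(S.Gam p) → ℝ) :
    S.i q (fun γ : ↥(S.Gam q) => (S.i p x) (γ : Γ)) = S.i p x := by
  rcases h.lt_or_eq with h | rfl
  · exact (S.compatible p q h x).symm
  · congr 1
    funext γ
    exact S.isExtension p x γ

theorem i_mem_span {Γ : Type} (S : BDSystem Γ) (q : ℕ) :
    ∀ x : ↥(S.Gam q) → ℝ, S.i q x ∈ Submodule.span ℝ (Set.range S.dvec) := by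
  classical
  induction q with
  | zero =>
    intro x
    have : x = 0 := by
      funext γ
      exact absurd (S.Gam_zero.le γ.2) (Finset.notMem_empty _)
    rw [this, map_zero]
    exact Submodule.zero_mem _
  | succ q ih =>
    intro x
    have hsub : S.Gam q ⊆ S.Gam (q + 1) := S.mono.monotone (Nat.le_succ q)
    set v : ↥(S.Gam q) → ℝ := fun γ => x ⟨γ, hsub γ.2⟩ with hv
    set u : ↥(S.Gam (q + 1)) → ℝ := x - fun γ : ↥(S.Gam (q + 1)) => (S.i q v) (γ : Γ) with hu
    have h1 : S.i (q + 1) x = S.i (q + 1) u + S.i q v := by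
      rw [hu, map_sub, S.i_restr (Nat.le_succ q), sub_add_cancel]
    rw [h1]
    refine Submodule.add_mem _ ?_ (ih v)
    have h2 : u = ∑ γ, u γ • (fun η : ↥(S.Gam (q + 1)) =>
        @ite _ ((η : Γ) = (γ : Γ)) (Classical.dec _) (1 : ℝ) 0) := by
      funext η
      rw [Finset.sum_apply, Finset.sum_eq_single η]
      · simp
      · intro b _ hb
        simp [Ne.symm hb]
      · simp
    rw [h2, map_sum]
    refine Submodule.sum_mem _ fun γ _ => ?_
    rw [map_smul]
    by_cases hγ : (γ : Γ) ∈ S.Gam q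
    · have : u γ = 0 := by
        have := S.isExtension q v ⟨γ, hγ⟩
        simp only [hu, Pi.sub_apply]
        rw [this]
        simp [hv]
      rw [this, zero_smul]
      exact Submodule.zero_mem _
    · have hr : S.rank (γ : Γ) = q + 1 := by
        have h3 := S.rank_le γ.2
        rw [S.mem_Gam_iff] at hγ
        omega
      rw [S.dvec_eq hr]
      exact Submodule.smul_mem _ _ (Submodule.subset_span ⟨_, rfl⟩)

theorem i_mem_X {Γ : Type} (S : BDSystem Γ) (q : ℕ) (x : ↥(S.Gam q) → ℝ) : S.i q x ∈ S.X :=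
  Submodule.le_topologicalClosure _ (S.i_mem_span q x)

theorem evalX_apply' {Γ : Type} (S : BDSystem Γ) (γ : Γ) (z : ↥S.X) :
    S.evalX γ z = (z : Linfty Γ) γ := rfl

theorem dstar_apply' {Γ : Type} (S : BDSystem Γ) (γ : Γ) (z : ↥S.X) :
    S.dstar γ z = (z : Linfty Γ) γ -
      (S.i (S.rank γ - 1) (fun η => (z : Linfty Γ) (η : Γ))) γ := by
  have h := S.isExtension (S.rank γ) (fun η => (z : Linfty Γ) (η : Γ)) ⟨γ, S.rank_spec γ⟩
  simp only at h
  rw [← h]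
  rfl

theorem span_finite {Γ : Type} (S : BDSystem Γ) (Γ' : Set Γ) (f : StrongDual ℝ ↥S.X)
    (hf : f ∈ Submodule.span ℝ (S.evalX '' Γ')) :
    ∃ n, ∀ z : ↥S.X, (∀ η ∈ Γ', η ∈ S.Gam n → (z : Linfty Γ) η = 0) → f z = 0 := by
  induction hf using Submodule.span_induction with
  | mem f hf =>
    obtain ⟨η, hη, rfl⟩ := hf
    exact ⟨S.rank η, fun z hz => hz η hη (S.rank_spec η)⟩
  | zero => exact ⟨0, fun z _ => rfl⟩
  | add f g _ _ hf hg =>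
    obtain ⟨n, hn⟩ := hf
    obtain ⟨m, hm⟩ := hg
    refine ⟨max n m, fun z hz => ?_⟩
    have h1 := hn z fun η h h' => hz η h (S.mono.monotone (le_max_left n m) h')
    have h2 := hm z fun η h h' => hz η h (S.mono.monotone (le_max_right n m) h')
    change f z + g z = 0
    rw [h1, h2, add_zero]
  | smul c f _ hf =>
    obtain ⟨n, hn⟩ := hf
    refine ⟨n, fun z hz => ?_⟩
    change c * f z = 0
    rw [hn z hz, mul_zero]

theorem step_zero {Γ : Type} (S : BDSystem Γ) (Γ' : Set Γ) (hsd : S.SelfDetermined Γ')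
    (γ : Γ) (hγ : γ ∈ Γ') (w : ↥(S.Gam (S.rank γ - 1)) → ℝ)
    (hw : ∀ η : ↥(S.Gam (S.rank γ - 1)), (η : Γ) ∈ Γ' → w η = 0) :
    (S.i (S.rank γ - 1) w) γ = 0 := by
  classical
  obtain ⟨n, hn⟩ := S.span_finite Γ' _ (hsd.2 γ hγ)
  set m := max n (S.rank γ) with hm
  set w' : ↥(S.Gam m) → ℝ :=
    fun η => if h : (η : Γ) ∈ S.Gam (S.rank γ - 1) then w ⟨η, h⟩ else 0 with hw'
  have hz : ∀ η ∈ Γ', η ∈ S.Gam m → (S.i m w') η = 0 := by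
    intro η h h'
    have := S.isExtension m w' ⟨η, h'⟩
    simp only at this
    rw [this]
    simp only [hw']
    split_ifs with h3
    · exact hw ⟨η, h3⟩ h
    · rfl
  have h0 := hn ⟨S.i m w', S.i_mem_X m w'⟩
    fun η h h' => hz η h (S.mono.monotone (le_max_left _ _) h')
  rw [S.dstar_apply'] at h0
  have h1 : (S.i m w') γ = 0 := hz γ hγ (S.mono.monotone (le_max_right _ _) (S.rank_spec γ))
  have h2 : (fun η : ↥(S.Gam (S.rank γ - 1)) => (S.i m w') (η : Γ)) = w := by
    funext η
    have hle : S.rank γ - 1 ≤ m := by omega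
    have := S.isExtension m w' ⟨η, S.mono.monotone hle η.2⟩
    simp only at this
    rw [this]
    simp [hw']
  simp only [h1, h2, zero_sub, neg_eq_zero] at h0
  exact h0

theorem vanish {Γ : Type} (S : BDSystem Γ) (Γ' : Set Γ) (hsd : S.SelfDetermined Γ') (q : ℕ)
    (x : ↥(S.Gam q) → ℝ) (hx : ∀ η : ↥(S.Gam q), (η : Γ) ∈ Γ' → x η = 0) :
    ∀ (p : ℕ) (γ : Γ), γ ∈ Γ' → S.rank γ = p → (S.i q x) γ = 0 := by
  intro p
  induction p using Nat.strong_induction_on with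
  | _ p ih =>
    intro γ hγ hp
    by_cases hq : γ ∈ S.Gam q
    · rw [S.isExtension q x ⟨γ, hq⟩]
      exact hx _ hγ
    · have hr : q ≤ S.rank γ - 1 := by
        rw [S.mem_Gam_iff] at hq
        omega
      have hpos : S.rank γ ≠ 0 := by
        intro h
        have := S.rank_spec γ
        rw [h, S.Gam_zero] at this
        simp at this
      rw [← S.i_restr hr x]
      refine S.step_zero Γ' hsd γ hγ _ fun η hη => ?_
      have := S.rank_le η.2
      exact ih (S.rank η) (by omega) η hη rfl

theorem restr_vanish {Γ : Type} (S : BDSystem Γ) (Γ' : Set Γ) (hsd : S.SelfDetermined Γ')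
    (q : ℕ) (x : ↥(S.Gam q) → ℝ) (hx : ∀ η : ↥(S.Gam q), (η : Γ) ∈ Γ' → x η = 0) :
    restrSet Γ' (S.i q x) = 0 := by
  ext γ
  exact S.vanish Γ' hsd q x hx _ γ γ.2 rfl

theorem restr_congr {Γ : Type} (S : BDSystem Γ) (Γ' : Set Γ) (hsd : S.SelfDetermined Γ')
    (q : ℕ) (x y : ↥(S.Gam q) → ℝ) (h : ∀ η : ↥(S.Gam q), (η : Γ) ∈ Γ' → x η = y η) :
    restrSet Γ' (S.i q x) = restrSet Γ' (S.i q y) := by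
  rw [← sub_eq_zero, ← map_sub, ← map_sub]
  exact S.restr_vanish Γ' hsd q _ fun η hη => sub_eq_zero.mpr (h η hη)

end BDSystem

/-- Let `Γ'` be a self-determined subset of `Γ`, and let `q_0 < q_1 < ⋯`
enumerate `{q : Γ' ∩ Δ_q ≠ ∅}`.  Then for every `s` and every `x ∈ ℓ∞(Γ_{q_s})`,
`R (i_{q_s} x) = i'_{q_s} (x|_{Γ'_{q_s}})`; equivalently `R (i_{q_s} x)` depends only on the
restriction of `x` to `Γ'_{q_s}`; in particular it vanishes when `x` does on `Γ'_{q_s}`. -/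
theorem restr_i_eq_iInd_resSub {Γ : Type} (S : BDSystem Γ) (Γ' : Set Γ)
    (hsd : S.SelfDetermined Γ') (qs : ℕ → ℕ) (hqs : StrictMono qs)
    (hrange : ∀ q : ℕ, (∃ γ ∈ Γ', S.rank γ = q) ↔ ∃ s, qs s = q) :
    (∀ (s : ℕ) (x : ↥(S.Gam (qs s)) → ℝ),
      restrSet Γ' (S.i (qs s) x) = S.iInd Γ' (qs s) (resSub Γ' (S.Gam (qs s)) x)) ∧
    (∀ (s : ℕ) (x y : ↥(S.Gam (qs s)) → ℝ),
      (∀ η : ↥(S.Gam (qs s)), (η : Γ) ∈ Γ' → x η = y η) →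
        restrSet Γ' (S.i (qs s) x) = restrSet Γ' (S.i (qs s) y)) ∧
    (∀ (s : ℕ) (x : ↥(S.Gam (qs s)) → ℝ),
      (∀ η : ↥(S.Gam (qs s)), (η : Γ) ∈ Γ' → x η = 0) →
        restrSet Γ' (S.i (qs s) x) = 0) := by
  refine ⟨fun s x => ?_, fun s => S.restr_congr Γ' hsd (qs s),
    fun s => S.restr_vanish Γ' hsd (qs s)⟩
  refine S.restr_congr Γ' hsd (qs s) x _ fun η hη => ?_
  simp [extZero, resSub, hη]
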